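/- Best-response (Nash) dynamics in CC-MAR converge in at most w_max · k² · |E| steps: if P⁰, P¹, …, P^T is a sequence of strategy profiles of a CC-MAR instance with k agents such that each P^{t+1} is obtained from P^t by a single agent replacing its path with one that strictly decreases that agent's individual cost, then T ≤ w_max · k² · |E|, where w_max is the maximum edge weight. -/

import Mathlib

/-- A mixed graph: a set `E` of undirected edges (non-diagonal `Sym2`s) and
a set `A` of arcs (ordered pairs of distinct vertices). -/
structure MixedGraph (V : Type*) where
  E : Finset (Sym2 V)
  A : Finset (V × V)
  not_diag : ∀ e ∈ E, ¬ e.IsDiag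
  arc_ne : ∀ a ∈ A, a.1 ≠ a.2

variable {V : Type*} [DecidableEq V]

/-- One step of a path: along an undirected edge or along an arc (in its direction). -/
def MixedGraph.Step (G : MixedGraph V) (u v : V) : Prop :=
  s(u, v) ∈ G.E ∨ (u, v) ∈ G.A

instance (G : MixedGraph V) : DecidableRel G.Step :=
  fun _ _ => inferInstanceAs (Decidable (_ ∨ _))

/-- `G.IsPath s t P`: `P` is a path from `s` to `t` in the mixed graph `G`:
a sequence of pairwise distinct vertices starting at `s`, ending at `t`, each
consecutive step being along an edge or an arc in its direction. -/
def MixedGraph.IsPath (G : MixedGraph V) (s t : V) (P : List V) : Prop :=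
  P.Nodup ∧ P.head? = some s ∧ P.getLast? = some t ∧ P.Chain' G.Step

/-- `traverses P u v`: the path `P` moves from `u` directly to `v`. -/
def traverses (P : List V) (u v : V) : Prop := (u, v) ∈ P.zip P.tail

instance (P : List V) (u v : V) : Decidable (traverses P u v) :=
  inferInstanceAs (Decidable ((u, v) ∈ P.zip P.tail))

/-- 0/1 indicator of `traverses P u v`. -/
def dirInd (P : List V) (u v : V) : ℕ := if traverses P u v then 1 else 0

variable {ι : Type*} [Fintype ι] [DecidableEq ι]

/-- `x_{(u,v)}`: the number of agents whose path traverses the edge `{u,v}` from `u` to `v`. -/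
def dirCount (P : ι → List V) (u v : V) : ℕ :=
  (Finset.univ.filter fun i => traverses (P i) u v).card

/-- The total cost `Σ_{e={u,v} ∈ E} w_e · x_{(u,v)} · x_{(v,u)}` of a strategy profile. -/
def MixedGraph.totalCost (G : MixedGraph V) (w : Sym2 V → ℕ) (P : ι → List V) : ℕ :=
  ∑ e ∈ G.E, Sym2.lift ⟨fun u v => w s(u, v) * (dirCount P u v * dirCount P v u),
    by intro a b; dsimp only; rw [show s(b, a) = s(a, b) from Sym2.eq_swap]; ring⟩ e

/-- The crossing cost of two paths: the sum of `w_e` over edges `e ∈ E` that the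
two paths traverse in opposite directions. -/
def MixedGraph.crossCost (G : MixedGraph V) (w : Sym2 V → ℕ) (P Q : List V) : ℕ :=
  ∑ e ∈ G.E, Sym2.lift ⟨fun u v =>
      w s(u, v) * (dirInd P u v * dirInd Q v u + dirInd P v u * dirInd Q u v),
    by intro a b; dsimp only; rw [show s(b, a) = s(a, b) from Sym2.eq_swap]; ring⟩ e

/-- Number of agents other than `i` traversing from `u` to `v`. -/
def oppCount (P : ι → List V) (i : ι) (u v : V) : ℕ :=
  (Finset.univ.filter fun j => j ≠ i ∧ traverses (P j) u v).card

/-- The individual cost of agent `i`: for each edge `e` traversed by `P i`,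
`w_e` times the number of other agents traversing `e` in the opposite direction. -/
def MixedGraph.indivCost (G : MixedGraph V) (w : Sym2 V → ℕ) (P : ι → List V) (i : ι) : ℕ :=
  ∑ e ∈ G.E, Sym2.lift ⟨fun u v =>
      w s(u, v) * (dirInd (P i) u v * oppCount P i v u + dirInd (P i) v u * oppCount P i u v),
    by intro a b; dsimp only; rw [show s(b, a) = s(a, b) from Sym2.eq_swap]; ring⟩ e

/-- A strategy profile: for each terminal pair `T i = (sᵢ, tᵢ)`, an `sᵢ`–`tᵢ` path. -/
def MixedGraph.IsProfile (G : MixedGraph V) (T : ι → V × V) (P : ι → List V) : Prop :=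
  ∀ i, G.IsPath (T i).1 (T i).2 (P i)

/-- A pure Nash equilibrium: no agent can strictly decrease its individual cost
by unilaterally switching to another path between its terminals. -/
def MixedGraph.IsNash (G : MixedGraph V) (w : Sym2 V → ℕ) (T : ι → V × V)
    (P : ι → List V) : Prop :=
  ∀ i (P' : List V), G.IsPath (T i).1 (T i).2 P' →
    G.indivCost w P i ≤ G.indivCost w (Function.update P i P') i

theorem not_traverses_swap {P : List V} (hP : P.Nodup) {u v : V} (h : traverses P u v) :
    ¬ traverses P v u := by
  intro h'
  obtain ⟨i, hi, hiuv⟩ := List.mem_iff_getElem.1 h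
  obtain ⟨j, hj, hjvu⟩ := List.mem_iff_getElem.1 h'
  simp only [List.length_zip, List.length_tail] at hi hj
  simp only [List.getElem_zip, List.getElem_tail, Prod.mk.injEq] at hiuv hjvu
  have h₁ : i = j + 1 := (hP.getElem_inj_iff).1 (hiuv.1.trans hjvu.2.symm)
  have h₂ : i + 1 = j := (hP.getElem_inj_iff).1 (hiuv.2.trans hjvu.1.symm)
  omega

theorem dirInd_mul_dirInd_swap {P : List V} (hP : P.Nodup) (u v : V) :
    dirInd P u v * dirInd P v u = 0 := by
  by_cases h : traverses P u v
  · simp [dirInd, not_traverses_swap hP h]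
  · simp [dirInd, h]

theorem dirCount_eq_oppCount_add_dirInd (P : ι → List V) (i : ι) (u v : V) :
    dirCount P u v = oppCount P i u v + dirInd (P i) u v := by
  simp only [dirCount, oppCount, dirInd, Finset.card_filter]
  rw [← Finset.add_sum_erase _ _ (Finset.mem_univ i),
    ← Finset.add_sum_erase _ (fun j => if j ≠ i ∧ traverses (P j) u v then 1 else 0)
      (Finset.mem_univ i)]
  have h : ∀ j ∈ Finset.univ.erase i, (if traverses (P j) u v then 1 else 0) =
      if j ≠ i ∧ traverses (P j) u v then 1 else 0 := fun j hj => by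
    simp [Finset.ne_of_mem_erase hj]
  rw [Finset.sum_congr rfl h]
  simp [add_comm]

theorem oppCount_update (P : ι → List V) (i : ι) (Q : List V) (u v : V) :
    oppCount (Function.update P i Q) i u v = oppCount P i u v := by
  unfold oppCount
  congr 1
  ext j
  by_cases h : j = i <;> simp [h]

theorem dirCount_le_card (P : ι → List V) (u v : V) : dirCount P u v ≤ Fintype.card ι :=
  Finset.card_le_univ _

/-- The total cost of the agents other than `i`. -/
def MixedGraph.restCost (G : MixedGraph V) (w : Sym2 V → ℕ) (P : ι → List V) (i : ι) : ℕ :=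
  ∑ e ∈ G.E, Sym2.lift ⟨fun u v => w s(u, v) * (oppCount P i u v * oppCount P i v u),
    by intro a b; dsimp only; rw [show s(b, a) = s(a, b) from Sym2.eq_swap]; ring⟩ e

theorem MixedGraph.restCost_update (G : MixedGraph V) (w : Sym2 V → ℕ) (P : ι → List V) (i : ι)
    (Q : List V) : G.restCost w (Function.update P i Q) i = G.restCost w P i := by
  simp only [MixedGraph.restCost, oppCount_update]

theorem MixedGraph.totalCost_eq_restCost_add_indivCost (G : MixedGraph V) (w : Sym2 V → ℕ)
    (P : ι → List V) (i : ι) (hP : (P i).Nodup) :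
    G.totalCost w P = G.restCost w P i + G.indivCost w P i := by
  unfold MixedGraph.totalCost MixedGraph.restCost MixedGraph.indivCost
  rw [← Finset.sum_add_distrib]
  refine Finset.sum_congr rfl fun e _ => ?_
  induction e using Sym2.ind with
  | _ u v =>
    simp only [Sym2.lift_mk, dirCount_eq_oppCount_add_dirInd P i]
    linear_combination w s(u, v) * dirInd_mul_dirInd_swap hP u v

theorem MixedGraph.totalCost_le (G : MixedGraph V) (w : Sym2 V → ℕ) (P : ι → List V) :
    G.totalCost w P ≤ G.E.sup w * Fintype.card ι ^ 2 * G.E.card := by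
  rw [mul_comm, ← smul_eq_mul]
  refine Finset.sum_le_card_nsmul _ _ _ fun e he => ?_
  induction e using Sym2.ind with
  | _ u v =>
    rw [Sym2.lift_mk, sq]
    exact Nat.mul_le_mul (Finset.le_sup he)
      (Nat.mul_le_mul (dirCount_le_card P u v) (dirCount_le_card P v u))

/-- The total cost is a potential function for the individual costs. -/
theorem MixedGraph.totalCost_update_lt (G : MixedGraph V) (w : Sym2 V → ℕ) (P : ι → List V)
    (i : ι) (Q : List V) (hP : (P i).Nodup) (hQ : Q.Nodup)
    (h : G.indivCost w (Function.update P i Q) i < G.indivCost w P i) :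
    G.totalCost w (Function.update P i Q) < G.totalCost w P := by
  rw [G.totalCost_eq_restCost_add_indivCost w P i hP,
    G.totalCost_eq_restCost_add_indivCost w (Function.update P i Q) i (by simpa using hQ),
    G.restCost_update]
  exact Nat.add_lt_add_left h _

/-- best-response dynamics converge in at most `w_max · k² · |E|` steps:
any sequence of strategy profiles in which each profile arises from the previous one
by a single agent strictly decreasing its individual cost has length at most
`w_max · k² · |E|`. -/
theorem stmt5 {k N : ℕ} (G : MixedGraph V) (w : Sym2 V → ℕ) (hw : ∀ e ∈ G.E, 0 < w e)
    (T : Fin k → V × V) (hT : ∀ i, (T i).1 ≠ (T i).2)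
    (Pseq : ℕ → Fin k → List V)
    (hprof : ∀ t ≤ N, G.IsProfile T (Pseq t))
    (hstep : ∀ t < N, ∃ i : Fin k,
      Pseq (t + 1) = Function.update (Pseq t) i (Pseq (t + 1) i) ∧
      G.indivCost w (Pseq (t + 1)) i < G.indivCost w (Pseq t) i) :
    N ≤ G.E.sup w * k ^ 2 * G.E.card := by
  have key : ∀ t ≤ N, t + G.totalCost w (Pseq t) ≤ G.totalCost w (Pseq 0) := by
    intro t
    induction t with
    | zero => simp
    | succ t ih =>
      intro ht
      obtain ⟨i, hupd, hlt⟩ := hstep t ht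
      have hlt' : G.totalCost w (Pseq (t + 1)) < G.totalCost w (Pseq t) := by
        rw [hupd] at hlt ⊢
        exact G.totalCost_update_lt w (Pseq t) i _ (hprof t (by omega) i).1
          (hprof (t + 1) ht i).1 hlt
      have := ih (by omega)
      omega
  have hbound := G.totalCost_le w (Pseq 0)
  rw [Fintype.card_fin] at hbound
  have := key N le_rfl
  omega
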